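/- Let L be a free abelian group of rank 2n with an action of the dihedral group D = ⟨t,u⟩ of order 8 whose central involution acts as -1, and suppose u acts on L/Tel(t) with d Jordan blocks of size 2 and e of size 1. Let B(u) = (L(u-1) + 2Tel(t))/2Tel(t). Then |B(u)| = 2^(n+d). -/

import Mathlib

/-- The `+1`-eigenlattice of an involution `t` on `L`. -/
def eigP {L : Type*} [AddCommGroup L] (t : Module.End ℤ L) : Submodule ℤ L :=
  LinearMap.ker (t - 1)

/-- The `-1`-eigenlattice of an involution `t` on `L`. -/
def eigM {L : Type*} [AddCommGroup L] (t : Module.End ℤ L) : Submodule ℤ L :=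
  LinearMap.ker (t + 1)

/-- The total eigenlattice `Tel(t) = L^+(t) + L^-(t)`. -/
def Tel {L : Type*} [AddCommGroup L] (t : Module.End ℤ L) : Submodule ℤ L :=
  eigP t ⊔ eigM t


/-- The doubled total eigenlattice `2·Tel(t)`. -/
def twoTel {L : Type*} [AddCommGroup L] (t : Module.End ℤ L) : Submodule ℤ L :=
  Submodule.map ((2 : ℤ) • (1 : Module.End ℤ L)) (Tel t)

/-- The commutator module `B(g) = (L(g-1) + 2Tel(t))/2Tel(t)` inside `L/2Tel(t)`. -/
def Bmod {L : Type*} [AddCommGroup L] (t g : Module.End ℤ L) :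
    Submodule ℤ (L ⧸ twoTel t) :=
  Submodule.map (twoTel t).mkQ (LinearMap.range (g - 1))

theorem natCard_map_mkQ {L : Type*} [AddCommGroup L] (N S : Submodule ℤ L) :
    Nat.card (S.map N.mkQ) = N.toAddSubgroup.relIndex S.toAddSubgroup := by
  have h := AddSubgroup.relIndex_ker S.toAddSubgroup N.mkQ.toAddMonoidHom
  have hk : N.mkQ.toAddMonoidHom.ker = N.toAddSubgroup := by
    ext x
    simp [AddMonoidHom.mem_ker]
  rw [hk] at h
  rw [h]
  rfl

/-- The order of the image of `S` modulo `A` factors through any `B ≥ A`. -/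
theorem natCard_map_mkQ_mul {L : Type*} [AddCommGroup L] {A B : Submodule ℤ L} (hAB : A ≤ B)
    (S : Submodule ℤ L) :
    Nat.card ((B ⊓ S).map A.mkQ) * Nat.card (S.map B.mkQ) = Nat.card (S.map A.mkQ) := by
  simp only [natCard_map_mkQ]
  have h := AddSubgroup.relIndex_inf_mul_relIndex A.toAddSubgroup B.toAddSubgroup S.toAddSubgroup
  rwa [inf_eq_left.2 (Submodule.toAddSubgroup_le _ _ |>.2 hAB)] at h

theorem natCard_map_mkQ_range {L M : Type*} [AddCommGroup L] [AddCommGroup M]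
    [Module.Free ℤ M] [Module.Finite ℤ M] (f : M →ₗ[ℤ] L) (A : Submodule ℤ L) (k : ℕ) [NeZero k]
    (h : A.comap f = LinearMap.range (LinearMap.lsmul ℤ M k)) :
    Nat.card ((LinearMap.range f).map A.mkQ) = k ^ Module.finrank ℤ M := by
  rw [← ModN.natCard_eq, ← LinearMap.range_comp]
  have hk : LinearMap.ker (A.mkQ ∘ₗ f) = LinearMap.range (LinearMap.lsmul ℤ M k) := by
    rw [LinearMap.ker_comp, Submodule.ker_mkQ, h]
  exact Nat.card_congr ((Submodule.quotEquivOfEq _ _ hk.symm).trans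
    (A.mkQ ∘ₗ f).quotKerEquivRange).symm.toEquiv

section Dihedral

variable {L : Type*} [AddCommGroup L] {t u : Module.End ℤ L}

theorem mem_eigP {x : L} : x ∈ eigP t ↔ t x = x := by
  simp [eigP, sub_eq_zero]

theorem mem_eigM {x : L} : x ∈ eigM t ↔ t x = -x := by
  simp [eigM, add_eq_zero_iff_eq_neg]

theorem apply_apply_of_mul_self (ht : t * t = 1) (x : L) : t (t x) = x := by
  simpa using LinearMap.congr_fun ht x

theorem anticomm_apply (ht : t * t = 1) (hu : u * u = 1) (hz : (t * u) * (t * u) = -1) (x : L) :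
    t (u x) = -u (t x) := by
  have h : t (u (t (u (u (t x))))) = -(u (t x)) := by
    simpa using LinearMap.congr_fun hz (u (t x))
  rwa [apply_apply_of_mul_self hu, apply_apply_of_mul_self ht] at h

theorem apply_mem_eigP (h : ∀ x, t (u x) = -u (t x)) {x : L} (hx : x ∈ eigM t) :
    u x ∈ eigP t := by
  rw [mem_eigP, h, mem_eigM.1 hx, map_neg, neg_neg]

theorem apply_mem_eigM (h : ∀ x, t (u x) = -u (t x)) {x : L} (hx : x ∈ eigP t) :
    u x ∈ eigM t := by
  rw [mem_eigM, h, mem_eigP.1 hx]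

theorem eq_of_add_eq_add [IsAddTorsionFree L] {a a' b b' : L} (ha : a ∈ eigP t) (ha' : a' ∈ eigP t)
    (hb : b ∈ eigM t) (hb' : b' ∈ eigM t) (h : a + b = a' + b') : a = a' ∧ b = b' := by
  have h2 := congrArg t h
  rw [map_add, map_add, mem_eigP.1 ha, mem_eigP.1 ha', mem_eigM.1 hb, mem_eigM.1 hb'] at h2
  have h3 : a = a' := by
    apply nsmul_right_injective (two_ne_zero : (2 : ℕ) ≠ 0)
    change 2 • a = 2 • a'
    calc 2 • a = (a + b) + (a + -b) := by abel
      _ = 2 • a' := by rw [h, h2]; abel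
  subst h3
  exact ⟨rfl, add_left_cancel h⟩

/-- The map `x ↦ x·u - x` on the `+1`-eigenlattice of `t`. -/
def commEigP (t u : Module.End ℤ L) : eigP t →ₗ[ℤ] L :=
  (u - 1) ∘ₗ (eigP t).subtype

theorem commEigP_apply (x : eigP t) : commEigP t u x = u x - x := by
  simp [commEigP]

theorem Tel_inf_range_sub_one [IsAddTorsionFree L] (hu : u * u = 1)
    (h : ∀ x, t (u x) = -u (t x)) :
    Tel t ⊓ LinearMap.range (u - 1) = LinearMap.range (commEigP t u) := by
  ext x
  constructor
  · rintro ⟨hx, y, rfl⟩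
    obtain ⟨a, ha, b, hb, hab⟩ := Submodule.mem_sup.1 hx
    have hy : u ((u - 1) y) = -(u - 1) y := by
      simp [apply_apply_of_mul_self hu]
    rw [← hab, map_add, neg_add, add_comm] at hy
    obtain ⟨-, hb'⟩ := eq_of_add_eq_add (apply_mem_eigP h hb) (neg_mem ha)
      (apply_mem_eigM h ha) (neg_mem hb) hy
    refine ⟨⟨-a, neg_mem ha⟩, ?_⟩
    rw [commEigP_apply, ← hab, map_neg, hb', neg_neg, sub_neg_eq_add, add_comm]
  · rintro ⟨a, rfl⟩
    refine ⟨?_, (a : L), by simp [commEigP_apply]⟩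
    rw [commEigP_apply]
    exact sub_mem (Submodule.mem_sup_right (apply_mem_eigM h a.2)) (Submodule.mem_sup_left a.2)

theorem comap_commEigP_twoTel [IsAddTorsionFree L] (h : ∀ x, t (u x) = -u (t x)) :
    (twoTel t).comap (commEigP t u) =
      LinearMap.range (LinearMap.lsmul ℤ (eigP t) (2 : ℕ)) := by
  ext x
  constructor
  · rintro ⟨y, hy, hyx⟩
    obtain ⟨a, ha, b, hb, rfl⟩ := Submodule.mem_sup.1 hy
    replace hyx : (2 : ℤ) • a + (2 : ℤ) • b = -(x : L) + u x := by
      rw [← smul_add, neg_add_eq_sub, ← commEigP_apply]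
      rw [← hyx]
      simp [two_smul]
      abel
    obtain ⟨hx, -⟩ := eq_of_add_eq_add (Submodule.smul_mem _ 2 ha) (neg_mem x.2)
      (Submodule.smul_mem _ 2 hb) (apply_mem_eigM h x.2) hyx
    refine ⟨⟨-a, neg_mem ha⟩, Subtype.ext ?_⟩
    simp only [LinearMap.lsmul_apply, Submodule.coe_smul, Nat.cast_ofNat, smul_neg, hx, neg_neg]
  · rintro ⟨y, rfl⟩
    refine ⟨u y - y, sub_mem (Submodule.mem_sup_right (apply_mem_eigM h y.2))
      (Submodule.mem_sup_left y.2), ?_⟩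
    simp [commEigP_apply, two_smul]
    abel

theorem finrank_eigP_add_finrank_eigM [Module.Free ℤ L] [Module.Finite ℤ L] (ht : t * t = 1) :
    Module.finrank ℤ (eigP t) + Module.finrank ℤ (eigM t) = Module.finrank ℤ L := by
  have htt := apply_apply_of_mul_self ht
  have hle : LinearMap.range (t - 1) ≤ eigM t := by
    rintro _ ⟨x, rfl⟩
    rw [mem_eigM]
    simp [htt]
  have hmap : ∀ x : eigM t, (-(2 : ℤ) • (eigM t).subtype) x ∈ LinearMap.range (t - 1) := by
    intro x
    refine ⟨x, ?_⟩
    simp [mem_eigM.1 x.2, two_smul]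
    abel
  have hinj : Function.Injective (LinearMap.codRestrict _ (-(2 : ℤ) • (eigM t).subtype) hmap) := by
    intro x y hxy
    have := congrArg Subtype.val hxy
    simpa using this
  have h1 := Submodule.finrank_mono hle
  have h2 := LinearMap.finrank_le_finrank_of_injective hinj
  have h3 := Submodule.finrank_quotient_add_finrank (eigP t)
  have h4 : Module.finrank ℤ (L ⧸ eigP t) = Module.finrank ℤ (LinearMap.range (t - 1)) :=
    (LinearMap.quotKerEquivRange (t - 1)).finrank_eq
  omega

theorem finrank_eigP_eq_finrank_eigM [Module.Free ℤ L] [Module.Finite ℤ L] (hu : u * u = 1)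
    (h : ∀ x, t (u x) = -u (t x)) :
    Module.finrank ℤ (eigP t) = Module.finrank ℤ (eigM t) := by
  have huu := apply_apply_of_mul_self hu
  have hinj : Function.Injective u := Function.LeftInverse.injective huu
  refine le_antisymm
    (LinearMap.finrank_le_finrank_of_injective (f := u.restrict fun _ hx => apply_mem_eigM h hx) ?_)
    (LinearMap.finrank_le_finrank_of_injective (f := u.restrict fun _ hx => apply_mem_eigP h hx) ?_)
  all_goals exact fun x y hxy => Subtype.ext (hinj (congrArg Subtype.val hxy))

theorem twoTel_le_Tel : twoTel t ≤ Tel t := by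
  rintro _ ⟨x, hx, rfl⟩
  exact Submodule.smul_mem _ (2 : ℤ) hx

end Dihedral

/-- With `d`, `e` the numbers of Jordan blocks of sizes 2, 1 for `u` on `L/Tel(t)`,
the module `B(u) = (L(u-1) + 2Tel(t))/2Tel(t)` has order `2^(n+d)`. -/
theorem card_bmod_u {L : Type*} [AddCommGroup L]
    [Module.Free ℤ L] [Module.Finite ℤ L] (n d e : ℕ)
    (hrank : Module.finrank ℤ L = 2 * n)
    (t u : Module.End ℤ L) (ht : t * t = 1) (hu : u * u = 1)
    (hz : (t * u) * (t * u) = -1)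
    (hd : Nat.card (Submodule.map (Tel t).mkQ (LinearMap.range (u - 1))) = 2 ^ d)
    (he : Nat.card (Submodule.map (Tel t).mkQ (Submodule.comap (u - 1) (Tel t)))
        = 2 ^ (d + e)) :
    Nat.card (Bmod t u) = 2 ^ (n + d) := by
  have h := anticomm_apply ht hu hz
  have : IsAddTorsionFree L := Module.isTorsionFree_int_iff_isAddTorsionFree.1 inferInstance
  have hn : Module.finrank ℤ (eigP t) = n := by
    have h1 := finrank_eigP_add_finrank_eigM ht
    have h2 := finrank_eigP_eq_finrank_eigM hu h
    omega
  rw [Bmod, ← natCard_map_mkQ_mul twoTel_le_Tel, hd, Tel_inf_range_sub_one hu h,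
    natCard_map_mkQ_range _ _ 2 (comap_commEigP_twoTel h), hn, pow_add]
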